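/- The number of unreachable diagrams D with |D| ≤ n equals the sum, over all nonempty sets T of file intervals, of (−1)^{|T|+1} · #{diagrams D : |D| ≤ n and |D ∩ v_u| > |u| for every u ∈ T}, where T ranges over the nonempty subsets of the (finite) set of all file intervals [u_l, u_r] with 1 ≤ u_l ≤ u_r ≤ n. -/

import Mathlib

/-- A square: file `s.1` with `1 ≤ s.1 ≤ n`, rank `s.2` with `2 ≤ s.2 ≤ n - 1`. -/
def IsSq (n : ℕ) (s : ℤ × ℤ) : Prop :=
  1 ≤ s.1 ∧ s.1 ≤ (n : ℤ) ∧ 2 ≤ s.2 ∧ s.2 ≤ (n : ℤ) - 1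

/-- The potential starting files of a pawn on square `s`. -/
noncomputable def mu (n : ℕ) (s : ℤ × ℤ) : Finset ℤ :=
  Finset.Icc (max 1 (s.1 - (s.2 - 2))) (min (n : ℤ) (s.1 + (s.2 - 2)))

/-- `u` is a file interval `[u.1, u.2]` with `1 ≤ u.1 ≤ u.2 ≤ n`. -/
def IsInterval (n : ℕ) (u : ℤ × ℤ) : Prop :=
  1 ≤ u.1 ∧ u.1 ≤ u.2 ∧ u.2 ≤ (n : ℤ)

/-- All squares of the board. -/
noncomputable def board (n : ℕ) : Finset (ℤ × ℤ) :=
  Finset.Icc 1 (n : ℤ) ×ˢ Finset.Icc 2 ((n : ℤ) - 1)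

/-- The squares whose potential starting files all lie inside the interval `u`
(the empty set when `u.1 > u.2`). -/
noncomputable def vset (n : ℕ) (u : ℤ × ℤ) : Finset (ℤ × ℤ) :=
  (board n).filter (fun s => mu n s ⊆ Finset.Icc u.1 u.2)

/-- The number of files of the interval `u`, i.e. `u.2 - u.1 + 1`. -/
def isize (u : ℤ × ℤ) : ℕ := (u.2 - u.1 + 1).toNat

/-- A diagram is a finite set of squares. -/
def IsDiagram (n : ℕ) (D : Finset (ℤ × ℤ)) : Prop := ∀ s ∈ D, IsSq n s

/-- A family `U` of file intervals is satisfiable if some diagram with at most `n`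
pawns has more than `|u|` pawns inside `vset n u` for every `u ∈ U`. -/
def Satisfiable (n : ℕ) (U : Finset (ℤ × ℤ)) : Prop :=
  ∃ D : Finset (ℤ × ℤ), IsDiagram n D ∧ D.card ≤ n ∧
    ∀ u ∈ U, isize u < (D ∩ vset n u).card

/-- A single pawn move. -/
def Move (n : ℕ) (D D' : Finset (ℤ × ℤ)) : Prop :=
  ∃ f r f' : ℤ, (f, r) ∈ D ∧ r ≤ (n : ℤ) - 2 ∧ |f' - f| ≤ 1 ∧ 1 ≤ f' ∧ f' ≤ (n : ℤ) ∧
    (f', r + 1) ∉ D ∧ D' = insert (f', r + 1) (D.erase (f, r))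

/-- A diagram is reachable if it is obtained by finitely many single pawn moves
from a diagram consisting only of squares of rank 2. -/
def Reachable (n : ℕ) (D : Finset (ℤ × ℤ)) : Prop :=
  ∃ D₀ : Finset (ℤ × ℤ), IsDiagram n D₀ ∧ (∀ s ∈ D₀, s.2 = 2) ∧
    Relation.ReflTransGen (Move n) D₀ D

/-- The finite set of all file intervals `[u_l, u_r]` with `1 ≤ u_l ≤ u_r ≤ n`. -/
noncomputable def allIntervals (n : ℕ) : Finset (ℤ × ℤ) :=
  (Finset.Icc 1 (n : ℤ) ×ˢ Finset.Icc 1 (n : ℤ)).filter (fun u => u.1 ≤ u.2)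

/-- There is an injective assignment of starting files. -/
def HasMatching (n : ℕ) (D : Finset (ℤ × ℤ)) : Prop :=
  ∃ g : ℤ × ℤ → ℤ, Set.InjOn g (D : Set (ℤ × ℤ)) ∧ ∀ s ∈ D, g s ∈ mu n s

lemma mem_mu_iff (n : ℕ) (s : ℤ × ℤ) (x : ℤ) :
    x ∈ mu n s ↔ 1 ≤ x ∧ x ≤ n ∧ s.1 - (s.2 - 2) ≤ x ∧ x ≤ s.1 + (s.2 - 2) := by
  simp only [mu, Finset.mem_Icc]
  omega

lemma hasMatching_move {n : ℕ} {D D' : Finset (ℤ × ℤ)} (hD : HasMatching n D)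
    (hm : Move n D D') : HasMatching n D' := by
  obtain ⟨g, hinj, hg⟩ := hD
  obtain ⟨f, r, f', hfr, -, habs, h1, h2, hnot, rfl⟩ := hm
  rw [abs_le] at habs
  refine ⟨Function.update g (f', r + 1) (g (f, r)), ?_, ?_⟩
  · have key : ∀ s ∈ D.erase (f, r), g s ≠ g (f, r) ∧ s ≠ (f', r + 1) := by
      intro s hs
      rw [Finset.mem_erase] at hs
      refine ⟨fun h => hs.1 (hinj hs.2 hfr h), ?_⟩
      rintro rfl
      exact hnot hs.2
    intro a ha b hb hab
    rw [Finset.mem_coe, Finset.mem_insert] at ha hb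
    rcases ha with rfl | ha <;> rcases hb with rfl | hb
    · rfl
    · rw [Function.update_self, Function.update_of_ne (key b hb).2] at hab
      exact absurd hab.symm (key b hb).1
    · rw [Function.update_self, Function.update_of_ne (key a ha).2] at hab
      exact absurd hab (key a ha).1
    · rw [Function.update_of_ne (key a ha).2, Function.update_of_ne (key b hb).2] at hab
      exact hinj (Finset.mem_of_mem_erase ha) (Finset.mem_of_mem_erase hb) hab
  · intro s hs
    rw [Finset.mem_insert] at hs
    rcases hs with rfl | hs
    · rw [Function.update_self]
      have := hg _ hfr
      rw [mem_mu_iff] at this ⊢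
      dsimp only at this ⊢
      omega
    · rw [Finset.mem_erase] at hs
      rw [Function.update_of_ne (by rintro rfl; exact hnot hs.2)]
      exact hg _ hs.2

lemma hasMatching_of_reachable {n : ℕ} {D : Finset (ℤ × ℤ)} (h : Reachable n D) :
    HasMatching n D := by
  obtain ⟨D₀, hd, h2, hr⟩ := h
  induction hr with
  | refl =>
    refine ⟨fun s => s.1, ?_, ?_⟩
    · intro a ha b hb hab
      exact Prod.ext hab ((h2 a ha).trans (h2 b hb).symm)
    · intro s hs
      have := hd s hs
      have := h2 s hs
      unfold IsSq at *
      rw [mem_mu_iff]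
      dsimp only
      omega
  | tail _ hm ih => exact hasMatching_move ih hm

lemma reachable_of_hasMatching_aux {n : ℕ} (k : ℕ) : ∀ D : Finset (ℤ × ℤ),
    ∑ s ∈ D, (s.2 - 2).toNat = k → IsDiagram n D → HasMatching n D → Reachable n D := by
  induction k using Nat.strong_induction_on with
  | _ k ih =>
  intro D hk hd hm
  by_cases hall : ∀ s ∈ D, s.2 = 2
  · exact ⟨D, hd, hall, Relation.ReflTransGen.refl⟩
  push Not at hall
  obtain ⟨s₀, hs₀, hs₀2⟩ := hall
  obtain ⟨⟨f, r⟩, hfr, hmin⟩ := Finset.exists_min_image (D.filter (fun s => s.2 ≠ 2))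
    (fun s => s.2) ⟨s₀, by simp [hs₀, hs₀2]⟩
  rw [Finset.mem_filter] at hfr
  obtain ⟨hfr, hr2⟩ := hfr
  dsimp only at hr2 hmin
  obtain ⟨g, hinj, hg⟩ := hm
  have hsq := hd _ hfr
  have hmu := hg _ hfr
  rw [mem_mu_iff] at hmu
  unfold IsSq at hsq
  dsimp only at hsq hmu
  obtain ⟨f', hf'1, hf'2, hf'3, hf'4, hf'5, hf'6⟩ : ∃ f' : ℤ, -1 ≤ f - f' ∧ f - f' ≤ 1 ∧ 1 ≤ f' ∧ f' ≤ n ∧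
      f' - (r - 3) ≤ g (f, r) ∧ g (f, r) ≤ f' + (r - 3) := by
    rcases lt_trichotomy (g (f, r)) f with h | h | h
    · exact ⟨f - 1, by omega⟩
    · exact ⟨f, by omega⟩
    · exact ⟨f + 1, by omega⟩
  have hnot : (f', r - 1) ∉ D := by
    intro hmem
    by_cases h3 : r - 1 = 2
    · have h4 := hg _ hmem
      rw [mem_mu_iff] at h4
      dsimp only at h4
      have := hinj hmem hfr (by omega)
      simp at this
    · have := hmin _ (Finset.mem_filter.2 ⟨hmem, h3⟩)
      dsimp only at this
      omega
  set D' := insert (f', r - 1) (D.erase (f, r)) with hD'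
  have hnot' : (f', r - 1) ∉ D.erase (f, r) := fun h => hnot (Finset.mem_of_mem_erase h)
  have hmove : Move n D' D := by
    refine ⟨f', r - 1, f, by simp [hD'], by omega, by rw [abs_le]; omega, by omega, by omega, ?_, ?_⟩
    · simp [hD']; omega
    · rw [hD', Finset.erase_insert hnot']
      simp [Finset.insert_erase hfr]
  have hreach : Reachable n D' := by
    refine ih _ ?_ D' rfl ?_ ?_
    · rw [← hk, hD', Finset.sum_insert hnot', ← Finset.add_sum_erase D _ hfr]
      dsimp only
      omega
    · intro s hs
      rw [hD', Finset.mem_insert] at hs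
      rcases hs with rfl | hs
      · unfold IsSq
        dsimp only
        omega
      · exact hd s (Finset.mem_of_mem_erase hs)
    · refine ⟨Function.update g (f', r - 1) (g (f, r)), ?_, ?_⟩
      · have key : ∀ s ∈ D.erase (f, r), g s ≠ g (f, r) ∧ s ≠ (f', r - 1) := by
          intro s hs
          rw [Finset.mem_erase] at hs
          refine ⟨fun h => hs.1 (hinj hs.2 hfr h), ?_⟩
          rintro rfl
          exact hnot hs.2
        intro a ha b hb hab
        rw [Finset.mem_coe, Finset.mem_insert] at ha hb
        rcases ha with rfl | ha <;> rcases hb with rfl | hb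
        · rfl
        · rw [Function.update_self, Function.update_of_ne (key b hb).2] at hab
          exact absurd hab.symm (key b hb).1
        · rw [Function.update_self, Function.update_of_ne (key a ha).2] at hab
          exact absurd hab (key a ha).1
        · rw [Function.update_of_ne (key a ha).2, Function.update_of_ne (key b hb).2] at hab
          exact hinj (Finset.mem_of_mem_erase ha) (Finset.mem_of_mem_erase hb) hab
      · intro s hs
        rw [Finset.mem_insert] at hs
        rcases hs with rfl | hs
        · rw [Function.update_self, mem_mu_iff]
          dsimp only
          omega
        · rw [Finset.mem_erase] at hs
          rw [Function.update_of_ne (by rintro rfl; exact hnot hs.2)]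
          exact hg _ hs.2
  obtain ⟨D₀, h1, h2, h3⟩ := hreach
  exact ⟨D₀, h1, h2, h3.tail hmove⟩

lemma reachable_iff_hasMatching {n : ℕ} {D : Finset (ℤ × ℤ)} (hd : IsDiagram n D) :
    Reachable n D ↔ HasMatching n D :=
  ⟨hasMatching_of_reachable, reachable_of_hasMatching_aux _ D rfl hd⟩

/-- The interval version of Hall's condition implies the version for all sets of files. -/
lemma hall_of_interval {n : ℕ} {D : Finset (ℤ × ℤ)} (hd : IsDiagram n D)
    (h : ∀ u ∈ allIntervals n, (D ∩ vset n u).card ≤ isize u) (k : ℕ) :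
    ∀ A : Finset ℤ, A.card = k → A ⊆ Finset.Icc 1 (n : ℤ) →
      (D.filter (fun s => mu n s ⊆ A)).card ≤ A.card := by
  have hne : ∀ s ∈ D, s.1 ∈ mu n s := by
    intro s hs
    have := hd s hs
    unfold IsSq at this
    rw [mem_mu_iff]
    omega
  induction k using Nat.strong_induction_on with
  | _ k ih =>
  intro A hk hA
  rcases A.eq_empty_or_nonempty with rfl | hAne
  · rw [Finset.card_empty, Nat.le_zero, Finset.card_eq_zero, Finset.filter_eq_empty_iff]
    intro s hs hsub
    exact absurd (hsub (hne s hs)) (by simp)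
  obtain ⟨m, hmA, hmin⟩ := Finset.exists_min_image A id hAne
  dsimp only [id] at hmin
  have hmn := Finset.mem_Icc.1 (hA hmA)
  obtain ⟨x, hx, hxmin⟩ := Finset.exists_min_image
    ((Finset.Icc m ((n : ℤ) + 1)).filter (fun x => x ∉ A)) id
    ⟨(n : ℤ) + 1, by
      rw [Finset.mem_filter, Finset.mem_Icc]
      refine ⟨by omega, fun hc => ?_⟩
      have := Finset.mem_Icc.1 (hA hc)
      omega⟩
  rw [Finset.mem_filter, Finset.mem_Icc] at hx
  obtain ⟨hx, hxA⟩ := hx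
  dsimp only [id] at hxmin
  have hmx : m < x := lt_of_le_of_ne hx.1 (by rintro rfl; exact hxA hmA)
  have hI : Finset.Icc m (x - 1) ⊆ A := by
    intro y hy
    rw [Finset.mem_Icc] at hy
    by_contra hyA
    have := hxmin y (by rw [Finset.mem_filter, Finset.mem_Icc]; exact ⟨by omega, hyA⟩)
    omega
  have hcard := Finset.card_sdiff_add_card_eq_card hI
  have hpos : 0 < (Finset.Icc m (x - 1)).card :=
    Finset.card_pos.2 ⟨m, by rw [Finset.mem_Icc]; omega⟩
  have h1 := ih (A \ Finset.Icc m (x - 1)).card (by omega) _ rfl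
    (Finset.sdiff_subset.trans hA)
  have h2 := h (m, x - 1) (by
    simp only [allIntervals, Finset.mem_filter, Finset.mem_product, Finset.mem_Icc]
    omega)
  have h3 : isize (m, x - 1) = (Finset.Icc m (x - 1)).card := by
    rw [Int.card_Icc]
    unfold isize
    dsimp only
    congr 1
    ring
  have hsub : D.filter (fun s => mu n s ⊆ A) ⊆
      (D ∩ vset n (m, x - 1)) ∪ D.filter (fun s => mu n s ⊆ A \ Finset.Icc m (x - 1)) := by
    intro s hs
    rw [Finset.mem_filter] at hs
    obtain ⟨hs, hsA⟩ := hs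
    have hsq := hd s hs
    unfold IsSq at hsq
    have hxs : x ∉ mu n s := fun hc => hxA (hsA hc)
    rw [mem_mu_iff] at hxs
    rw [Finset.mem_union, Finset.mem_inter, Finset.mem_filter]
    by_cases hc : s.1 < x
    · left
      refine ⟨hs, ?_⟩
      simp only [vset, board, Finset.mem_filter, Finset.mem_product, Finset.mem_Icc]
      refine ⟨by omega, ?_⟩
      intro y hy
      have := hmin y (hsA hy)
      have hyx : y ≠ x := by rintro rfl; exact hxA (hsA hy)
      rw [mem_mu_iff] at hy
      rw [Finset.mem_Icc]
      omega
    · right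
      refine ⟨hs, ?_⟩
      intro y hy
      rw [Finset.mem_sdiff]
      refine ⟨hsA hy, ?_⟩
      rw [mem_mu_iff] at hy
      rw [Finset.mem_Icc]
      omega
  have h4 := (Finset.card_le_card hsub).trans (Finset.card_union_le _ _)
  omega

lemma reachable_iff {n : ℕ} {D : Finset (ℤ × ℤ)} (hd : IsDiagram n D) :
    Reachable n D ↔ ∀ u ∈ allIntervals n, (D ∩ vset n u).card ≤ isize u := by
  rw [reachable_iff_hasMatching hd]
  constructor
  · rintro ⟨g, hinj, hg⟩ u hu
    have h3 : isize u = (Finset.Icc u.1 u.2).card := by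
      rw [Int.card_Icc]
      unfold isize
      congr 1
      ring
    rw [h3]
    refine Finset.card_le_card_of_injOn g ?_ ?_
    · intro s hs
      have hs := Finset.mem_inter.1 hs
      exact (Finset.mem_filter.1 hs.2).2 (hg s hs.1)
    · exact hinj.mono (by simp)
  · intro h
    have hall : ∀ S : Finset D, S.card ≤ (S.biUnion (fun s => mu n s.1)).card := by
      intro S
      refine le_trans ?_ (hall_of_interval hd h _ (S.biUnion (fun s => mu n s.1)) rfl ?_)
      · refine Finset.card_le_card_of_injOn (fun s => s.1) ?_ Subtype.val_injective.injOn
        intro s hs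
        rw [Finset.mem_coe, Finset.mem_filter]
        exact ⟨s.2, Finset.subset_biUnion_of_mem (fun s : D => mu n s.1) hs⟩
      · intro x hx
        rw [Finset.mem_biUnion] at hx
        obtain ⟨s, -, hx⟩ := hx
        rw [mem_mu_iff] at hx
        rw [Finset.mem_Icc]
        omega
    obtain ⟨g, hinj, hg⟩ :=
      (Finset.all_card_le_biUnion_card_iff_exists_injective (fun s : D => mu n s.1)).1 hall
    refine ⟨fun s => if hs : s ∈ D then g ⟨s, hs⟩ else 0, ?_, ?_⟩
    · intro a ha b hb hab
      rw [Finset.mem_coe] at ha hb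
      simp only [ha, hb, dif_pos] at hab
      exact congrArg Subtype.val (hinj hab)
    · intro s hs
      simp only [hs, dif_pos]
      exact hg ⟨s, hs⟩

open scoped Classical in
/-- inclusion–exclusion count of unreachable diagrams with at most
`n` pawns, over nonempty sets `T` of file intervals. -/
theorem count_unreachable_by_inclusion_exclusion (n : ℕ) (hn : 3 ≤ n) :
    (((board n).powerset.filter
        (fun D => D.card ≤ n ∧ ¬ Reachable n D)).card : ℤ)
    = ∑ T ∈ (allIntervals n).powerset.filter (fun T => T.Nonempty),
        (-1 : ℤ) ^ (T.card + 1) *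
          ((board n).powerset.filter
            (fun D => D.card ≤ n ∧
              ∀ u ∈ T, isize u < (D ∩ vset n u).card)).card := by
  have hU : (board n).powerset.filter (fun D => D.card ≤ n ∧ ¬ Reachable n D) =
      (allIntervals n).biUnion (fun u => (board n).powerset.filter
        (fun D => D.card ≤ n ∧ isize u < (D ∩ vset n u).card)) := by
    ext D
    simp only [Finset.mem_filter, Finset.mem_biUnion, Finset.mem_powerset]
    by_cases hD : D ⊆ board n
    · have hd : IsDiagram n D := by
        intro s hs
        have := hD hs
        simp only [board, Finset.mem_product, Finset.mem_Icc] at this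
        unfold IsSq
        omega
      rw [reachable_iff hd]
      push Not
      constructor
      · rintro ⟨h1, h2, u, hu, h3⟩
        exact ⟨u, hu, h1, h2, h3⟩
      · rintro ⟨u, hu, h1, h2, h3⟩
        exact ⟨h1, h2, u, hu, h3⟩
    · simp [hD]
  rw [hU, Finset.inclusion_exclusion_card_biUnion,
    ← Finset.sum_coe_sort ((allIntervals n).powerset.filter (fun T => T.Nonempty))]
  refine Finset.sum_congr rfl ?_
  rintro ⟨T, hT⟩ -
  have hTne := (Finset.mem_filter.1 hT).2
  congr 3
  ext D
  simp only [Finset.mem_inf', Finset.mem_filter]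
  constructor
  · intro hh
    obtain ⟨u, hu⟩ := hTne
    exact ⟨(hh u hu).1, (hh u hu).2.1, fun v hv => (hh v hv).2.2⟩
  · rintro ⟨h1, h2, h3⟩ u hu
    exact ⟨h1, h2, h3 u hu⟩
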